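/- Let α ≥ 0, k a positive integer, and p a real polynomial with p(0) ≠ 0. Let Λ(q) = x·q'' + (α+1)·q'. Let s be any real number larger than the magnitude of every root of L_k^α. Then there exists h₀ > 0 such that for all 0 < h < h₀, the polynomial exp(-hΛ)(x^k p(x)) has at least k distinct real roots in the interval (-2sh, 2sh). -/

import Mathlib

open Polynomial

/-- The operator Λ = x·d²/dx² + (α+1)·d/dx on real polynomials. -/
noncomputable def Lam (α : ℝ) (q : ℝ[X]) : ℝ[X] :=
  X * derivative (derivative q) + C (α + 1) * derivative q

/-- The (finite) operator exponential `exp(-hΛ)q = ∑_{j=0}^{deg q} (-h)^j Λ^j(q)/j!`. -/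
noncomputable def expL (α h : ℝ) (q : ℝ[X]) : ℝ[X] :=
  ∑ j ∈ Finset.range (q.natDegree + 1),
    C ((-h) ^ j / (Nat.factorial j)) * (Lam α)^[j] q

/-- The generalized Laguerre polynomial
`L_k^α(x) = ∑_{i=0}^k (-1)^i (Γ(k+α+1)/(Γ(α+i+1)(k-i)!)) x^i / i!`. -/
noncomputable def lag (α : ℝ) (k : ℕ) : ℝ[X] :=
  ∑ i ∈ Finset.range (k + 1),
    C ((-1 : ℝ) ^ i * (Real.Gamma ((k : ℝ) + α + 1) /
        (Real.Gamma (α + i + 1) * (Nat.factorial (k - i)))) / (Nat.factorial i)) * X ^ i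

open Filter Topology

/-- Rolle's theorem on a half-line. -/
theorem exists_hasDerivAt_eq_zero_of_tendsto_atTop {f f' : ℝ → ℝ} {a : ℝ}
    (hc : ContinuousOn f (Set.Ici a)) (hd : ∀ x, a < x → HasDerivAt f (f' x) x)
    (ha : f a = 0) (hlim : Tendsto f atTop (𝓝 0)) : ∃ c, a < c ∧ f' c = 0 := by
  have rolle : ∀ u v, a ≤ u → u < v → f u = f v → ∃ c, a < c ∧ f' c = 0 := by
    intro u v hu huv he
    obtain ⟨c, hcm, h0⟩ := exists_hasDerivAt_eq_zero huv
      (hc.mono fun x hx => hu.trans hx.1) he fun x hx => hd x (hu.trans_lt hx.1)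
    exact ⟨c, hu.trans_lt hcm.1, h0⟩
  by_cases hb : f (a + 1) = 0
  · exact rolle a (a + 1) le_rfl (by linarith) (by rw [ha, hb])
  obtain ⟨c, hcs, hbc⟩ : ∃ c, |f c| < |f (a + 1)| / 2 ∧ a + 1 < c := by
    have h1 : ∀ᶠ c in atTop, |f c| < |f (a + 1)| / 2 := by
      have := hlim.abs
      rw [abs_zero] at this
      exact this.eventually_lt_const (by positivity)
    exact (h1.and (eventually_gt_atTop _)).exists
  have hu : f (a + 1) / 2 ∈ Set.uIcc (f a) (f (a + 1)) := by
    rw [ha, Set.mem_uIcc]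
    rcases le_total 0 (f (a + 1)) with h | h
    · left; constructor <;> linarith
    · right; constructor <;> linarith
  have hv : f (a + 1) / 2 ∈ Set.uIcc (f (a + 1)) (f c) := by
    rw [Set.mem_uIcc]
    rcases le_total 0 (f (a + 1)) with h | h
    · rw [abs_of_nonneg h, abs_lt] at hcs
      right; constructor <;> linarith
    · rw [abs_of_nonpos h, abs_lt] at hcs
      left; constructor <;> linarith
  have hab : a ≤ a + 1 := by linarith
  obtain ⟨u, hum, hfu⟩ := intermediate_value_uIcc
    (hc.mono (by rw [Set.uIcc_of_le hab]; exact Set.Icc_subset_Ici_self)) hu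
  obtain ⟨v, hvm, hfv⟩ := intermediate_value_uIcc
    (hc.mono (by
      rw [Set.uIcc_of_le hbc.le]
      exact fun x hx => hab.trans hx.1)) hv
  rw [Set.uIcc_of_le hab] at hum
  rw [Set.uIcc_of_le hbc.le] at hvm
  refine rolle u v hum.1 (lt_of_le_of_ne (hum.2.trans hvm.1) ?_) (hfu.trans hfv.symm)
  rintro rfl
  have : u = a + 1 := le_antisymm hum.2 hvm.1
  rw [this] at hfu
  exact hb (by linarith)

theorem tendsto_rpow_mul_exp_neg_mul_eval_atTop (β : ℝ) (P : ℝ[X]) :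
    Tendsto (fun x : ℝ => x ^ β * Real.exp (-x) * P.eval x) atTop (𝓝 0) := by
  induction P using Polynomial.induction_on' with
  | add p q hp hq => simpa [mul_add] using hp.add hq
  | monomial n c =>
    have h := (tendsto_rpow_mul_exp_neg_mul_atTop_nhds_zero (β + n) 1 one_pos).const_mul c
    rw [mul_zero] at h
    refine h.congr' ?_
    filter_upwards [eventually_gt_atTop 0] with x hx
    rw [Real.rpow_add hx, Real.rpow_natCast, eval_monomial, neg_one_mul]
    ring

theorem hasDerivAt_rpow_mul_exp_neg_mul_eval (β : ℝ) (P : ℝ[X]) {x : ℝ} (hx : 0 < x) :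
    HasDerivAt (fun x : ℝ => x ^ (β + 1) * Real.exp (-x) * P.eval x)
      (x ^ β * Real.exp (-x) * (X * derivative P + (C (β + 1) - X) * P).eval x) x := by
  have h1 := Real.hasDerivAt_rpow_const (x := x) (p := β + 1) (Or.inl hx.ne')
  have h2 := (hasDerivAt_neg x).exp
  refine ((h1.mul h2).mul (P.hasDerivAt x)).congr_deriv ?_
  simp only [eval_add, eval_mul, eval_sub, eval_X, eval_C, add_sub_cancel_right,
    Real.rpow_add hx, Real.rpow_one, Pi.mul_apply]
  ring

theorem continuous_rpow_mul_exp_neg_mul_eval {β : ℝ} (hβ : 0 ≤ β) (P : ℝ[X]) :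
    Continuous (fun x : ℝ => x ^ β * Real.exp (-x) * P.eval x) :=
  ((Real.continuous_rpow_const hβ).mul (by fun_prop)).mul P.continuous

theorem factorial_mul_coeff_lag (α : ℝ) (k i : ℕ) :
    (k.factorial : ℝ) * (lag α k).coeff i =
      (-1) ^ i * k.choose i * (Real.Gamma (k + α + 1) / Real.Gamma (α + i + 1)) := by
  simp only [lag, finsetSum_coeff, coeff_C_mul, coeff_X_pow, mul_ite, mul_one, mul_zero,
    Finset.sum_ite_eq, Finset.mem_range]
  split_ifs with h
  · rw [Nat.cast_choose ℝ (Nat.lt_succ_iff.mp h)]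
    field_simp
  · rw [Nat.choose_eq_zero_of_lt (by omega)]
    simp

/-- The lowering relation `(k+1) L_{k+1}^α = x (L_k^{α+1})' + (α+1-x) L_k^{α+1}`. -/
theorem succ_mul_lag_succ {α : ℝ} (hα : 0 ≤ α) (k : ℕ) :
    C ((k : ℝ) + 1) * lag α (k + 1) =
      X * derivative (lag (α + 1) k) + (C (α + 1) - X) * lag (α + 1) k := by
  have hk : (k.factorial : ℝ) ≠ 0 := by positivity
  ext i
  apply mul_left_cancel₀ hk
  have h1 := factorial_mul_coeff_lag α (k + 1) i
  rw [Nat.factorial_succ] at h1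
  push_cast at h1
  have h2 := factorial_mul_coeff_lag (α + 1) k i
  have hG : Real.Gamma (k + 1 + α + 1) = Real.Gamma (k + (α + 1) + 1) := by ring_nf
  rw [coeff_C_mul, ← mul_assoc, mul_comm (k.factorial : ℝ), h1, hG]
  have hpos : 0 < α + i + 1 := by positivity
  have hrec : Real.Gamma (α + 1 + i + 1) = (α + i + 1) * Real.Gamma (α + i + 1) := by
    rw [← Real.Gamma_add_one hpos.ne']; ring_nf
  have hΓ := (Real.Gamma_pos_of_pos hpos).ne'
  rw [hrec] at h2
  cases i with
  | zero =>
    simp only [coeff_add, sub_mul, coeff_sub, coeff_X_mul_zero, coeff_C_mul, mul_add, mul_sub]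
    rw [mul_left_comm, h2]
    simp at hpos hΓ ⊢
    field_simp
  | succ i =>
    have h3 := factorial_mul_coeff_lag (α + 1) k i
    have hG3 : Real.Gamma (α + 1 + i + 1) = Real.Gamma (α + (i + 1 : ℕ) + 1) := by
      push_cast; ring_nf
    rw [hG3] at h3
    simp only [coeff_add, sub_mul, coeff_sub, coeff_X_mul, coeff_C_mul, coeff_derivative]
    have : (k.factorial : ℝ) * ((lag (α + 1) k).coeff (i + 1) * (i + 1) +
        ((α + 1) * (lag (α + 1) k).coeff (i + 1) - (lag (α + 1) k).coeff i)) =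
        (α + (i + 1 : ℕ) + 1) * (k.factorial * (lag (α + 1) k).coeff (i + 1)) -
          k.factorial * (lag (α + 1) k).coeff i := by push_cast; ring
    rw [this, h2, h3, Nat.choose_succ_succ]
    push_cast at hpos hΓ ⊢
    field_simp
    ring

/-- The generalized Laguerre polynomial `L_k^α` has `k` distinct positive zeros
`a 1 < ⋯ < a k`. -/
theorem exists_zeros_lag (k : ℕ) : ∀ α : ℝ, 0 ≤ α → ∃ a : ℕ → ℝ, a 0 = 0 ∧
    (∀ i < k, a i < a (i + 1)) ∧ ∀ i < k, (lag α k).eval (a (i + 1)) = 0 := by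
  induction k with
  | zero => exact fun α _ => ⟨fun _ => 0, by simp⟩
  | succ k ih =>
    intro α hα
    obtain ⟨a, ha0, hlt, hroot⟩ := ih (α + 1) (by linarith)
    set P := lag (α + 1) k with hP
    set g : ℝ → ℝ := fun x => x ^ (α + 1) * Real.exp (-x) * P.eval x with hg
    have hnn : ∀ i ≤ k, 0 ≤ a i := by
      intro i
      induction i with
      | zero => simp [ha0]
      | succ i ihi => exact fun h => (ihi (by omega)).trans (hlt i (by omega)).le
    have hg0 : ∀ i ≤ k, g (a i) = 0 := by
      intro i hi
      cases i with
      | zero => simp [hg, ha0, Real.zero_rpow (show α + 1 ≠ 0 by positivity)]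
      | succ i => simp [hg, hroot i (by omega)]
    have hgc : Continuous g := continuous_rpow_mul_exp_neg_mul_eval (by linarith) P
    have hzero : ∀ x, 0 < x →
        x ^ α * Real.exp (-x) * (X * derivative P + (C (α + 1) - X) * P).eval x = 0 →
        (lag α (k + 1)).eval x = 0 := by
      intro x hx h
      rw [← succ_mul_lag_succ hα, eval_mul, eval_C] at h
      have hx' : x ^ α * Real.exp (-x) ≠ 0 := by positivity
      have hk' : (k : ℝ) + 1 ≠ 0 := by positivity
      exact (mul_eq_zero.1 ((mul_eq_zero.1 h).resolve_left hx')).resolve_left hk'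
    have hξ : ∀ i, ∃ ξ, i ≤ k → a i < ξ ∧ (i < k → ξ < a (i + 1)) ∧
        (lag α (k + 1)).eval ξ = 0 := by
      intro i
      rcases lt_trichotomy i k with hi | rfl | hi
      · obtain ⟨c, hc, h0⟩ := exists_hasDerivAt_eq_zero (hlt i hi) hgc.continuousOn
          ((hg0 i hi.le).trans (hg0 (i + 1) hi).symm) fun x hx =>
            hasDerivAt_rpow_mul_exp_neg_mul_eval α P ((hnn i hi.le).trans_lt hx.1)
        exact ⟨c, fun _ => ⟨hc.1, fun _ => hc.2, hzero c ((hnn i hi.le).trans_lt hc.1) h0⟩⟩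
      · obtain ⟨c, hc, h0⟩ := exists_hasDerivAt_eq_zero_of_tendsto_atTop hgc.continuousOn
          (fun x hx => hasDerivAt_rpow_mul_exp_neg_mul_eval α P ((hnn i le_rfl).trans_lt hx))
          (hg0 i le_rfl) (tendsto_rpow_mul_exp_neg_mul_eval_atTop (α + 1) P)
        exact ⟨c, fun _ => ⟨hc, fun h => absurd h (lt_irrefl _),
          hzero c ((hnn i le_rfl).trans_lt hc) h0⟩⟩
      · exact ⟨0, fun h => absurd h (by omega)⟩
    choose ξ hξ using hξ
    refine ⟨fun i => Nat.casesOn i 0 ξ, rfl, ?_, fun i hi => (hξ i (by omega)).2.2⟩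
    intro i hi
    cases i with
    | zero => simpa [ha0] using (hξ 0 (by omega)).1
    | succ i =>
      exact ((hξ i (by omega)).2.1 (by omega)).trans (hξ (i + 1) (by omega)).1

theorem exists_finset_roots_lag {α : ℝ} (hα : 0 ≤ α) (k : ℕ) :
    ∃ t : Finset ℝ, t.card = k ∧ ∀ x ∈ t, (lag α k).eval x = 0 := by
  obtain ⟨a, -, hlt, hroot⟩ := exists_zeros_lag k α hα
  have hmono : ∀ i j, i < j → j ≤ k → a i < a j := by
    intro i j hij
    induction j, hij using Nat.le_induction with
    | base => exact fun h => hlt i h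
    | succ j _ ih => exact fun h => (ih (by omega)).trans (hlt j h)
  refine ⟨(Finset.range k).image fun i => a (i + 1), ?_, ?_⟩
  · rw [Finset.card_image_of_injOn, Finset.card_range]
    intro i hi j hj hij
    simp only [Finset.coe_range, Set.mem_Iio] at hi hj
    rcases lt_trichotomy i j with h | h | h
    · exact absurd hij (hmono _ _ (by omega) (by omega)).ne
    · exact h
    · exact absurd hij (hmono _ _ (by omega) (by omega)).ne'
  · simpa using hroot

theorem lag_ne_zero {α : ℝ} (hα : 0 ≤ α) (k : ℕ) : lag α k ≠ 0 := by
  intro h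
  have h0 := factorial_mul_coeff_lag α k 0
  have h1 := Real.Gamma_pos_of_pos (show 0 < k + α + 1 by positivity)
  have h2 := Real.Gamma_pos_of_pos (show 0 < α + 1 by positivity)
  simp [h] at h0
  exact (div_pos h1 h2).ne h0

theorem natDegree_lag_le (α : ℝ) (k : ℕ) : (lag α k).natDegree ≤ k := by
  refine natDegree_sum_le_of_forall_le _ _ fun i hi => ?_
  exact (natDegree_C_mul_X_pow_le _ _).trans (by simpa [Nat.lt_succ_iff] using hi)

/-- A polynomial with at least as many distinct roots as its degree has simple roots. -/
theorem eval_derivative_ne_zero_of_natDegree_le_card {P : ℝ[X]} (hP : P ≠ 0) {t : Finset ℝ}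
    (ht : ∀ x ∈ t, P.eval x = 0) (hdeg : P.natDegree ≤ t.card) {r : ℝ} (hr : r ∈ t) :
    (derivative P).eval r ≠ 0 := by
  have hle : t.val ≤ P.roots :=
    (Multiset.le_iff_subset t.nodup).2 fun x hx => (mem_roots hP).2 (ht x hx)
  have heq : t.val = P.roots :=
    Multiset.eq_of_le_of_card_le hle ((card_roots' P).trans hdeg)
  intro hd
  have h1 := (one_lt_rootMultiplicity_iff_isRoot hP).2 ⟨ht r hr, hd⟩
  rw [← count_roots, ← heq] at h1
  exact absurd (Multiset.nodup_iff_count_le_one.1 t.nodup r) (by omega)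

/-- A simple zero of `G h₀` persists, in any given neighbourhood, for `G h` with `h` near `h₀`. -/
theorem eventually_exists_zero_of_hasDerivAt {G : ℝ → ℝ → ℝ} {h₀ r d : ℝ} {V : Set ℝ}
    (hGh : ∀ y, ContinuousAt (fun h => G h y) h₀) (hGy : ∀ h, Continuous (G h))
    (h0 : G h₀ r = 0) (hd : HasDerivAt (G h₀) d r) (hd0 : d ≠ 0) (hV : V ∈ 𝓝 r) :
    ∀ᶠ h in 𝓝 h₀, ∃ y ∈ V, G h y = 0 := by
  obtain ⟨ε, hε, hball⟩ := Metric.mem_nhds_iff.1 hV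
  have hball_mem := Metric.ball_mem_nhds r hε
  obtain ⟨a, ha, haB⟩ : ∃ a, G h₀ a < 0 ∧ a ∈ Metric.ball r ε := by
    have : ∃ᶠ x in 𝓝 r, ¬ G h₀ r ≤ G h₀ x := fun h =>
      hd0 (IsLocalMin.hasDerivAt_eq_zero (by simpa [IsLocalMin, IsMinFilter] using h) hd)
    simpa [h0] using (this.and_eventually hball_mem).exists
  obtain ⟨b, hb, hbB⟩ : ∃ b, 0 < G h₀ b ∧ b ∈ Metric.ball r ε := by
    have : ∃ᶠ x in 𝓝 r, ¬ G h₀ x ≤ G h₀ r := fun h =>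
      hd0 (IsLocalMax.hasDerivAt_eq_zero (by simpa [IsLocalMax, IsMaxFilter] using h) hd)
    simpa [h0] using (this.and_eventually hball_mem).exists
  filter_upwards [(hGh a).eventually_lt_const ha, (hGh b).eventually_const_lt hb] with h hha hhb
  obtain ⟨y, hy, hy0⟩ := intermediate_value_uIcc (hGy h).continuousOn
    (show (0 : ℝ) ∈ Set.uIcc (G h a) (G h b) from Set.mem_uIcc.2 (Or.inl ⟨hha.le, hhb.le⟩))
  refine ⟨y, hball ?_, hy0⟩
  rw [Real.ball_eq_Ioo] at haB hbB ⊢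
  exact Set.OrdConnected.uIcc_subset Set.ordConnected_Ioo haB hbB hy

/-- If `t` consists of simple zeros of `G h₀` in the open set `W`, then `G h` has at least as many
zeros in `W` for all `h` near `h₀`. -/
theorem eventually_exists_finset_zeros {G : ℝ → ℝ → ℝ} {h₀ : ℝ} {W : Set ℝ} (hW : IsOpen W)
    (hGh : ∀ y, ContinuousAt (fun h => G h y) h₀) (hGy : ∀ h, Continuous (G h))
    (t : Finset ℝ) (htW : ∀ r ∈ t, r ∈ W)
    (ht : ∀ r ∈ t, G h₀ r = 0 ∧ ∃ d, d ≠ 0 ∧ HasDerivAt (G h₀) d r) :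
    ∀ᶠ h in 𝓝 h₀, ∃ u : Finset ℝ, u.card = t.card ∧ ∀ y ∈ u, y ∈ W ∧ G h y = 0 := by
  obtain ⟨U, hU, hdisj⟩ := t.finite_toSet.t2_separation
  have hev : ∀ᶠ h in 𝓝 h₀, ∀ r ∈ t, ∃ y ∈ U r ∩ W, G h y = 0 := by
    rw [Filter.eventually_all_finset]
    intro r hr
    obtain ⟨h0, d, hd0, hd⟩ := ht r hr
    exact eventually_exists_zero_of_hasDerivAt hGh hGy h0 hd hd0
      (((hU r).2.inter hW).mem_nhds ⟨(hU r).1, htW r hr⟩)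
  filter_upwards [hev] with h hh
  choose! y hyV hy0 using hh
  refine ⟨t.image y, Finset.card_image_of_injOn fun r hr r' hr' he => ?_, ?_⟩
  · by_contra hne
    exact Set.disjoint_left.1 (hdisj hr hr' hne) (hyV r hr).1 (by
      rw [he]
      exact (hyV r' hr').1)
  · intro z hz
    obtain ⟨r, hr, rfl⟩ := Finset.mem_image.1 hz
    exact ⟨(hyV r hr).2, hy0 r hr⟩

theorem isLinearMap_lam (α : ℝ) : IsLinearMap ℝ (Lam α) where
  map_add p q := by simp only [Lam, derivative_add]; ring
  map_smul c p := by
    simp only [Lam, derivative_smul, smul_add, mul_smul_comm]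

theorem iterate_lam_eq_pow (α : ℝ) (j : ℕ) :
    (Lam α)^[j] = ⇑(((isLinearMap_lam α).mk' (Lam α)) ^ j) := by
  rw [Module.End.coe_pow]
  rfl

theorem lam_C_mul_X_pow (α c : ℝ) (n : ℕ) :
    Lam α (C c * X ^ n) = C (c * (n * (n + α))) * X ^ (n - 1) := by
  rcases n with _ | _ | n
  · simp [Lam]
  · simp [Lam]
    ring
  · simp [Lam]
    ring

theorem iterate_lam_X_pow {α : ℝ} (hα : 0 ≤ α) (n j : ℕ) :
    (Lam α)^[j] (X ^ n) = C (n.descFactorial j *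
      (Real.Gamma (n + α + 1) / Real.Gamma (α + (n - j : ℕ) + 1))) * X ^ (n - j) := by
  induction j with
  | zero =>
    have := Real.Gamma_pos_of_pos (show 0 < α + n + 1 by positivity)
    have he : (n : ℝ) + α + 1 = α + n + 1 := by ring
    simp [he, this.ne']
  | succ j ih =>
    rw [Function.iterate_succ_apply', ih, lam_C_mul_X_pow, Nat.sub_sub]
    congr 2
    rcases lt_or_ge j n with h | h
    · obtain ⟨m, rfl⟩ := Nat.exists_eq_add_of_le (Nat.succ_le_of_lt h)
      have e1 : j.succ + m - j = m + 1 := by omega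
      have e2 : j.succ + m - (j + 1) = m := by omega
      rw [Nat.descFactorial_succ, e1, e2]
      have hrec : Real.Gamma (α + (m + 1 : ℕ) + 1) = (α + m + 1) * Real.Gamma (α + m + 1) := by
        rw [← Real.Gamma_add_one (by positivity)]; push_cast; ring_nf
      have := Real.Gamma_pos_of_pos (show 0 < α + m + 1 by positivity)
      rw [hrec]
      push_cast
      field_simp
      ring
    · rw [Nat.descFactorial_of_lt (by omega : n < j + 1), Nat.sub_eq_zero_of_le h]
      simp

/-- `exp(-hΛ) xⁿ`, evaluated at `h y`, is `(-h)ⁿ n! L_n^α(y)`. -/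
theorem sum_iterate_lam_X_pow_eval {α : ℝ} (hα : 0 ≤ α) {n N : ℕ} (hn : n ≤ N) (h y : ℝ) :
    ∑ j ∈ Finset.range (N + 1), (-h) ^ j / j.factorial * ((Lam α)^[j] (X ^ n)).eval (h * y) =
      (-h) ^ n * n.factorial * (lag α n).eval y := by
  have hsub : Finset.range (n + 1) ⊆ Finset.range (N + 1) := by
    simpa using hn
  rw [← Finset.sum_subset hsub, ← Finset.sum_range_reflect,
    eval_eq_sum_range' (Nat.lt_succ_of_le (natDegree_lag_le α n)), Finset.mul_sum]
  · refine Finset.sum_congr rfl fun i hi => ?_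
    have hin : i ≤ n := Nat.lt_succ_iff.1 (Finset.mem_range.1 hi)
    obtain ⟨m, rfl⟩ := Nat.exists_eq_add_of_le hin
    have e1 : i + m + 1 - 1 - i = m := by omega
    have e2 : i + m - m = i := by omega
    have hc := factorial_mul_coeff_lag α (i + m) i
    have hd : ((i + m).descFactorial m : ℝ) = m.factorial * (i + m).choose i := by
      rw [Nat.descFactorial_eq_factorial_mul_choose, Nat.choose_symm_add]
      push_cast
      ring
    rw [e1, iterate_lam_X_pow hα, e2, mul_assoc, ← mul_assoc ((i + m).factorial : ℝ), hc, hd]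
    have hm : (m.factorial : ℝ) ≠ 0 := by positivity
    simp only [eval_mul, eval_C, eval_pow, eval_X]
    have hs : ((-1 : ℝ)) ^ i * (-1) ^ i = 1 := by rw [← mul_pow]; simp
    rw [pow_add, neg_pow h i, mul_pow]
    field_simp
    linear_combination (-((-h) ^ m * h ^ i * (i + m).choose i * y ^ i)) * hs
  · intro j _ hj
    rw [iterate_lam_X_pow hα, Nat.descFactorial_of_lt (by simpa using hj)]
    simp

theorem expL_eval_mul {α : ℝ} (hα : 0 ≤ α) (q : ℝ[X]) (h y : ℝ) :
    (expL α h q).eval (h * y) = ∑ n ∈ Finset.range (q.natDegree + 1),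
      q.coeff n * ((-h) ^ n * n.factorial * (lag α n).eval y) := by
  have hq : ∀ j, ((Lam α)^[j] q).eval (h * y) = ∑ n ∈ Finset.range (q.natDegree + 1),
      q.coeff n * ((Lam α)^[j] (X ^ n)).eval (h * y) := by
    intro j
    conv_lhs => rw [q.as_sum_range_C_mul_X_pow]
    simp only [iterate_lam_eq_pow, ← smul_eq_C_mul, map_sum, map_smul, eval_finsetSum, eval_smul,
      smul_eq_mul]
  simp only [expL, eval_finsetSum, eval_mul, eval_C, hq, Finset.mul_sum]
  rw [Finset.sum_comm]
  refine Finset.sum_congr rfl fun n hn => ?_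
  rw [← sum_iterate_lam_X_pow_eval hα (Nat.lt_succ_iff.1 (Finset.mem_range.1 hn)),
    Finset.mul_sum]
  exact Finset.sum_congr rfl fun j _ => by ring

theorem stmt_12 (α : ℝ) (hα : 0 ≤ α) (k : ℕ) (hk : 1 ≤ k)
    (p : ℝ[X]) (hp : p.eval 0 ≠ 0) (s : ℝ)
    (hs : ∀ x : ℝ, (lag α k).eval x = 0 → |x| < s) :
    ∃ h₀ : ℝ, 0 < h₀ ∧ ∀ h : ℝ, 0 < h → h < h₀ →
      ∃ t : Finset ℝ, t.card = k ∧ ∀ x ∈ t,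
        x ∈ Set.Ioo (-(2 * s * h)) (2 * s * h) ∧
        (expL α h (X ^ k * p)).eval x = 0 := by
  set q := X ^ k * p with hq
  have hqlt : ∀ n < k, q.coeff n = 0 := fun n hn => by
    rw [hq, coeff_X_pow_mul', if_neg (by omega)]
  have hqk : q.coeff k ≠ 0 := by
    rwa [hq, coeff_X_pow_mul', if_pos le_rfl, Nat.sub_self, coeff_zero_eq_eval_zero]
  set G : ℝ → ℝ → ℝ := fun h y => ∑ n ∈ Finset.range (q.natDegree + 1),
    q.coeff n * ((-1) ^ n * h ^ (n - k) * n.factorial * (lag α n).eval y) with hG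
  have hscale : ∀ h y, (expL α h q).eval (h * y) = h ^ k * G h y := by
    intro h y
    rw [expL_eval_mul hα, hG, Finset.mul_sum]
    refine Finset.sum_congr rfl fun n _ => ?_
    rcases lt_or_ge n k with hn | hn
    · simp [hqlt n hn]
    · obtain ⟨m, rfl⟩ := Nat.exists_eq_add_of_le hn
      rw [Nat.add_sub_cancel_left, neg_pow h]
      ring
  set c : ℝ := q.coeff k * ((-1) ^ k * k.factorial) with hc
  have hc0 : c ≠ 0 := by
    have : (k.factorial : ℝ) ≠ 0 := by positivity
    simp [hc, hqk, this]
  have hG0 : G 0 = fun y => c * (lag α k).eval y := by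
    funext y
    rw [hG]
    simp only
    rw [Finset.sum_eq_single_of_mem k
      (Finset.mem_range.2 (Nat.lt_succ_of_le (le_natDegree_of_ne_zero hqk)))]
    · rw [hc, Nat.sub_self]
      ring
    · intro n _ hn
      rcases lt_or_gt_of_ne hn with h | h
      · simp [hqlt n h]
      · simp [zero_pow (by omega : n - k ≠ 0)]
  obtain ⟨t, htc, ht⟩ := exists_finset_roots_lag hα k
  have hev := eventually_exists_finset_zeros (G := G) (h₀ := 0) (W := Set.Ioo (-s) s) isOpen_Ioo
    (fun y => by simp only [hG]; fun_prop) (fun h => by simp only [hG]; fun_prop) t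
    (fun r hr => abs_lt.1 (hs r (ht r hr))) (fun r hr => ⟨by simp [hG0, ht r hr], _,
      mul_ne_zero hc0 (eval_derivative_ne_zero_of_natDegree_le_card (lag_ne_zero hα k) ht
        ((natDegree_lag_le α k).trans htc.ge) hr),
      by rw [hG0]; exact ((lag α k).hasDerivAt r).const_mul c⟩)
  obtain ⟨h₀, hh₀, hball⟩ := Metric.eventually_nhds_iff.1 hev
  refine ⟨h₀, hh₀, fun h hpos hlt => ?_⟩
  obtain ⟨u, huc, hu⟩ := hball (y := h) (by simpa [abs_of_pos hpos] using hlt)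
  refine ⟨u.image (h * ·), ?_, ?_⟩
  · rw [Finset.card_image_of_injective _ (mul_right_injective₀ hpos.ne'), huc, htc]
  · intro x hx
    obtain ⟨y, hy, rfl⟩ := Finset.mem_image.1 hx
    obtain ⟨⟨hy1, hy2⟩, hy0⟩ := hu y hy
    refine ⟨⟨?_, ?_⟩, by simp only [hscale, hy0, mul_zero]⟩ <;> nlinarith
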